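/- For every integer d ≥ 0 there is no continuous injective map from the d-skeleton of the (2d+2)-dimensional simplex into the 2d-sphere; concretely, there is no continuous injective map from X_d := { x ∈ ℝ^{2d+3} : x_i ≥ 0 for all i, ∑_i x_i = 1, and at most d+1 coordinates of x are nonzero } into S^{2d}, the unit sphere of ℝ^{2d+1}. -/

import Mathlib

/-- The geometric realization of the `d`-skeleton of the `(2d+2)`-dimensional simplex:
the set of points of the standard simplex in `ℝ^{2d+3}` having at most `d+1` nonzero
(barycentric) coordinates, with the subspace topology. -/
def VKskel (d : ℕ) : Type :=
  {x : Fin (2 * d + 3) → ℝ // (∀ i, 0 ≤ x i) ∧ (∑ i, x i) = 1 ∧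
    (Finset.univ.filter fun i => x i ≠ 0).card ≤ d + 1}

instance (d : ℕ) : TopologicalSpace (VKskel d) :=
  instTopologicalSpaceSubtype

namespace ListChain

/-- Mod 2 chains of ordered simplices, a simplex being the list of its vertices. -/
abbrev Chain (E : Type*) := List E →₀ ZMod 2

section Boundary

variable {E : Type*}

/-- The linear map prepending the vertex `v` to every simplex. -/
noncomputable def cone (v : E) : Chain E →ₗ[ZMod 2] Chain E :=
  Finsupp.lmapDomain _ _ (List.cons v)

/-- The boundary of a single simplex. -/
noncomputable def simplexBoundary : List E → Chain E
  | [] => 0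
  | v :: l => Finsupp.single l 1 + cone v (simplexBoundary l)

/-- The augmented mod 2 boundary operator. -/
noncomputable def boundary : Chain E →ₗ[ZMod 2] Chain E :=
  Finsupp.linearCombination _ simplexBoundary

@[simp] lemma cone_single (v : E) (l : List E) (r : ZMod 2) :
    cone v (Finsupp.single l r) = Finsupp.single (v :: l) r := by
  simp [cone]

@[simp] lemma boundary_single (l : List E) :
    boundary (Finsupp.single l 1) = simplexBoundary l := by
  simp [boundary]

lemma add_self (c : Chain E) : c + c = 0 := by
  ext l
  exact CharTwo.add_self_eq_zero (c l)

lemma boundary_cone (v : E) (c : Chain E) : boundary (cone v c) = c + cone v (boundary c) := by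
  have h : boundary ∘ₗ cone v = LinearMap.id + cone v ∘ₗ boundary := by
    ext l : 2
    simp [simplexBoundary]
  exact LinearMap.congr_fun h c

lemma boundary_simplexBoundary (l : List E) : boundary (simplexBoundary l) = 0 := by
  induction l with
  | nil => simp [simplexBoundary]
  | cons v l ih => simp [simplexBoundary, boundary_cone, ih, add_self]

lemma boundary_boundary (c : Chain E) : boundary (boundary c) = 0 := by
  have h : boundary ∘ₗ boundary = (0 : Chain E →ₗ[ZMod 2] Chain E) := by
    ext l : 2
    simp [boundary_simplexBoundary]
  exact LinearMap.congr_fun h c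

/-- The chains supported on simplices satisfying `P`. -/
abbrev chainsOn (P : List E → Prop) : Submodule (ZMod 2) (Chain E) :=
  Finsupp.supported (ZMod 2) (ZMod 2) {l | P l}

lemma single_mem_chainsOn {P : List E → Prop} {l : List E} (h : P l) :
    Finsupp.single l 1 ∈ chainsOn P :=
  Finsupp.single_mem_supported _ _ h

lemma chainsOn_induction {P : List E → Prop} {M : Type*} [AddCommGroup M] [Module (ZMod 2) M]
    (f : Chain E →ₗ[ZMod 2] M) (S : Submodule (ZMod 2) M)
    (h : ∀ l, P l → f (Finsupp.single l 1) ∈ S) {c : Chain E} (hc : c ∈ chainsOn P) :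
    f c ∈ S := by
  rw [chainsOn, Finsupp.supported_eq_span_single] at hc
  have : Submodule.span (ZMod 2) ((fun i : List E => Finsupp.single i (1 : ZMod 2)) '' {l | P l}) ≤
      S.comap f := by
    rw [Submodule.span_le]
    rintro _ ⟨l, hl, rfl⟩
    exact h l hl
  exact this hc

lemma eq_of_chainsOn {P : List E → Prop} {M : Type*} [AddCommGroup M] [Module (ZMod 2) M]
    (f g : Chain E →ₗ[ZMod 2] M)
    (h : ∀ l, P l → f (Finsupp.single l 1) = g (Finsupp.single l 1))
    {c : Chain E} (hc : c ∈ chainsOn P) : f c = g c := by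
  have := chainsOn_induction (f - g) ⊥ (fun l hl => by simp [h l hl]) hc
  simpa [sub_eq_zero] using this

lemma cone_mem_chainsOn {P Q : List E → Prop} {v : E} (h : ∀ l, P l → Q (v :: l))
    {c : Chain E} (hc : c ∈ chainsOn P) : cone v c ∈ chainsOn Q :=
  chainsOn_induction _ _ (fun l hl => by
    rw [cone_single]; exact single_mem_chainsOn (h l hl)) hc

lemma simplexBoundary_mem (l : List E) :
    simplexBoundary l ∈ chainsOn fun t => t.length + 1 = l.length ∧ t ⊆ l := by
  induction l with
  | nil => exact Submodule.zero_mem _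
  | cons v l ih =>
    refine Submodule.add_mem _ (single_mem_chainsOn ⟨rfl, by simp⟩) (cone_mem_chainsOn ?_ ih)
    rintro t ⟨h1, h2⟩
    exact ⟨by simp [h1], List.cons_subset_cons v h2⟩

lemma boundary_mem_chainsOn_length {n : ℕ} {c : Chain E}
    (hc : c ∈ chainsOn fun l => l.length = n + 1) :
    boundary c ∈ chainsOn fun l => l.length = n :=
  chainsOn_induction _ _ (fun l hl => by
    rw [boundary_single]
    exact Finsupp.supported_mono (fun t ht => by
      have := ht.1
      simp only [Set.mem_ofPred_eq]
      omega) (simplexBoundary_mem l)) hc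

lemma simplexBoundary_mem_length {n : ℕ} {l : List E} (hl : l.length = n + 1) :
    simplexBoundary l ∈ chainsOn fun t => t.length = n := by
  rw [← boundary_single]
  exact boundary_mem_chainsOn_length (single_mem_chainsOn hl)

end Boundary

section Antipode

variable {E : Type*} [AddCommGroup E]

/-- The antipodal map on chains. -/
noncomputable def antipode : Chain E →ₗ[ZMod 2] Chain E :=
  Finsupp.lmapDomain _ _ (List.map Neg.neg)

@[simp] lemma antipode_single (l : List E) (r : ZMod 2) :
    antipode (Finsupp.single l r) = Finsupp.single (l.map Neg.neg) r := by
  simp [antipode]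

lemma antipode_cone (v : E) (c : Chain E) : antipode (cone v c) = cone (-v) (antipode c) := by
  have h : antipode ∘ₗ cone v = cone (-v) ∘ₗ antipode := by
    ext l : 2
    simp
  exact LinearMap.congr_fun h c

lemma antipode_antipode (c : Chain E) : antipode (antipode c) = c := by
  have h : antipode ∘ₗ antipode = (LinearMap.id : Chain E →ₗ[ZMod 2] Chain E) := by
    ext l : 2
    simp
  exact LinearMap.congr_fun h c

lemma simplexBoundary_map_neg (l : List E) :
    simplexBoundary (l.map Neg.neg) = antipode (simplexBoundary l) := by
  induction l with
  | nil => simp [simplexBoundary]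
  | cons v l ih => simp [simplexBoundary, antipode_cone, ih]

lemma boundary_antipode (c : Chain E) : boundary (antipode c) = antipode (boundary c) := by
  have h : boundary ∘ₗ antipode = antipode ∘ₗ (boundary : Chain E →ₗ[ZMod 2] Chain E) := by
    ext l : 2
    simp [simplexBoundary_map_neg]
  exact LinearMap.congr_fun h c

lemma antipode_mem_chainsOn {P Q : List E → Prop} (h : ∀ l, P l → Q (l.map Neg.neg))
    {c : Chain E} (hc : c ∈ chainsOn P) : antipode c ∈ chainsOn Q :=
  chainsOn_induction _ _ (fun l hl => by
    rw [antipode_single]; exact single_mem_chainsOn (h l hl)) hc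

/-- Hemispheres of the boundaries of cross-polytopes with vertices `± v i`. -/
noncomputable def hemisphere (v : ℕ → E) : ℕ → Chain E
  | 0 => Finsupp.single [v 0] 1
  | k + 1 => cone (v (k + 1)) (hemisphere v k + antipode (hemisphere v k))

lemma boundary_hemisphere_succ (v : ℕ → E) (k : ℕ) :
    boundary (hemisphere v (k + 1)) = hemisphere v k + antipode (hemisphere v k) := by
  have h : boundary (hemisphere v k + antipode (hemisphere v k)) = 0 := by
    rw [map_add, boundary_antipode]
    cases k with
    | zero => simp [hemisphere, simplexBoundary, add_self]
    | succ k =>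
      rw [boundary_hemisphere_succ v k, map_add, antipode_antipode, add_comm (antipode _), add_self]
  rw [hemisphere, boundary_cone, h, map_zero, add_zero]

/-- Every simplex of the hemisphere has vertices `± v 0, …, ± v k`. -/
lemma hemisphere_mem (v : ℕ → E) (k : ℕ) :
    hemisphere v k ∈ chainsOn fun l => l.length = k + 1 ∧
      ∃ ε : ℕ → ℤˣ, ∀ x ∈ l, ∃ i ≤ k, x = (ε i : ℤ) • v i := by
  induction k with
  | zero => exact single_mem_chainsOn ⟨rfl, fun _ => 1, by simp⟩
  | succ k ih =>
    refine cone_mem_chainsOn (P := fun l => l.length = k + 1 ∧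
      ∃ ε : ℕ → ℤˣ, ∀ x ∈ l, ∃ i ≤ k, x = (ε i : ℤ) • v i) ?_
      (Submodule.add_mem _ ih (antipode_mem_chainsOn ?_ ih))
    · rintro l ⟨hl, ε, hε⟩
      refine ⟨by simp [hl], Function.update ε (k + 1) 1, ?_⟩
      intro x hx
      rcases List.mem_cons.1 hx with rfl | hx
      · exact ⟨k + 1, le_rfl, by simp⟩
      · obtain ⟨i, hi, rfl⟩ := hε x hx
        exact ⟨i, by omega, by rw [Function.update_of_ne (by omega)]⟩
    · rintro l ⟨hl, ε, hε⟩
      refine ⟨by simp [hl], fun i => - ε i, ?_⟩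
      intro x hx
      obtain ⟨y, hy, rfl⟩ := List.mem_map.1 hx
      obtain ⟨i, hi, rfl⟩ := hε y hy
      exact ⟨i, hi, by simp⟩

end Antipode

section Index

variable {E : Type*}

/-- The cup product `δ sₖ₋₁ ∪ ⋯ ∪ δ s₀` of coboundaries of `0`-cochains,
on a simplex with `k + 1` vertices. -/
def cup (s : ℕ → E → ZMod 2) : List E → ZMod 2
  | [] => 0
  | [_] => 1
  | x :: y :: l => (s l.length x + s l.length y) * cup s (y :: l)

/-- The cup product of the `0`-cochain `s k` with the cochain `cup s` on `k`-simplices. -/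
def cupHead (s : ℕ → E → ZMod 2) : List E → ZMod 2
  | [] => 0
  | x :: l => s l.length x * cup s (x :: l)

lemma cup_eq_zero {s : ℕ → E → ZMod 2} {l : List E} {i : ℕ} (hi : i + 1 < l.length)
    (h : ∀ x ∈ l, ∀ y ∈ l, s i x = s i y) : cup s l = 0 := by
  induction l with
  | nil => rfl
  | cons x l ih =>
    cases l with
    | nil => simp at hi
    | cons y l =>
      rw [cup]
      by_cases hil : i = l.length
      · subst hil
        rw [h x (by simp) y (by simp), CharTwo.add_self_eq_zero, zero_mul]
      · rw [ih (by simp at hi ⊢; omega) fun x hx y hy =>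
          h x (List.mem_cons_of_mem _ hx) y (List.mem_cons_of_mem _ hy), mul_zero]

/-- The linear extension of a cochain. -/
noncomputable abbrev pairing (φ : List E → ZMod 2) : Chain E →ₗ[ZMod 2] ZMod 2 :=
  Finsupp.linearCombination _ φ

lemma pairing_single (φ : List E → ZMod 2) (l : List E) : pairing φ (Finsupp.single l 1) = φ l := by
  simp [pairing]

lemma pairing_cupHead_cone (s : ℕ → E → ZMod 2) (x : E) {k : ℕ} {c : Chain E}
    (hc : c ∈ chainsOn fun l => l.length = k) :
    pairing (cupHead s) (cone x c) = s k x * pairing (cup s) (cone x c) := by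
  refine eq_of_chainsOn (pairing (cupHead s) ∘ₗ cone x) (s k x • (pairing (cup s) ∘ₗ cone x)) ?_ hc
  rintro l rfl
  simp [cupHead]

lemma pairing_cupHead_boundary (s : ℕ → E → ZMod 2) (k : ℕ) {c : Chain E}
    (hc : c ∈ chainsOn fun l => l.length = k + 2) :
    pairing (cupHead s) (boundary c) = pairing (cup s) c := by
  refine eq_of_chainsOn (pairing (cupHead s) ∘ₗ boundary) (pairing (cup s)) ?_ hc
  rintro (_ | ⟨x, _ | ⟨y, l⟩⟩) hl
  · simp at hl
  · simp at hl
  simp only [List.length_cons, Nat.add_right_cancel_iff] at hl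
  have hb : boundary (Finsupp.single (y :: l) 1) ∈ chainsOn fun t : List E => t.length = k :=
    boundary_mem_chainsOn_length (single_mem_chainsOn (by simp [hl]))
  have hcoc : pairing (cup s) (boundary (Finsupp.single (x :: y :: l) 1)) = 0 := by
    cases k with
    | zero =>
      obtain rfl := List.length_eq_zero_iff.1 hl
      simp [simplexBoundary, cup, CharTwo.add_self_eq_zero]
    | succ k =>
      rw [← pairing_cupHead_boundary s k, boundary_boundary, map_zero]
      exact boundary_mem_chainsOn_length (single_mem_chainsOn (by simp [hl]))
  rw [← cone_single, boundary_cone, map_add, pairing_single, CharTwo.add_eq_zero] at hcoc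
  rw [LinearMap.comp_apply, ← cone_single, boundary_cone, map_add, pairing_single,
    pairing_cupHead_cone s x hb, ← hcoc, cone_single, pairing_single, cupHead, cup, hl]
  ring

variable [AddCommGroup E]

lemma cup_map_neg {s : ℕ → E → ZMod 2} {l : List E}
    (h : ∀ i, ∀ x ∈ l, s i (-x) = s i x + 1) : cup s (l.map Neg.neg) = cup s l := by
  induction l with
  | nil => rfl
  | cons x l ih =>
    cases l with
    | nil => rfl
    | cons y l =>
      have ih := ih fun i x hx => h i x (List.mem_cons_of_mem _ hx)
      simp only [List.map_cons] at ih ⊢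
      rw [cup, cup, ih, h _ x (by simp), h _ y (by simp), List.length_map]
      congr 1
      linear_combination CharTwo.add_self_eq_zero (1 : ZMod 2)

lemma cupHead_add_map_neg {s : ℕ → E → ZMod 2} {l : List E} (hl : l ≠ [])
    (h : ∀ i, ∀ x ∈ l, s i (-x) = s i x + 1) :
    cupHead s l + cupHead s (l.map Neg.neg) = cup s l := by
  cases l with
  | nil => exact absurd rfl hl
  | cons x l =>
    have hn := cup_map_neg h
    simp only [List.map_cons] at hn ⊢
    rw [cupHead, cupHead, hn, h _ x (by simp), List.length_map]
    linear_combination cup s (x :: l) * CharTwo.add_self_eq_zero (s l.length x)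

/-- Odd `0`-cochains detect a sequence of chains whose boundaries are the symmetrizations of
their predecessors. -/
lemma pairing_cup_eq_one {s : ℕ → E → ZMod 2} {K : Set E}
    (hs : ∀ i, ∀ x ∈ K, s i (-x) = s i x + 1) {c : ℕ → Chain E} {x₀ : E}
    (h0 : c 0 = Finsupp.single [x₀] 1)
    (hc : ∀ k, c k ∈ chainsOn fun l => l.length = k + 1 ∧ ∀ x ∈ l, x ∈ K) (k : ℕ)
    (hb : ∀ j < k, boundary (c (j + 1)) = c j + antipode (c j)) :
    pairing (cup s) (c k) = 1 := by
  induction k with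
  | zero => rw [h0, pairing_single, cup]
  | succ k ih =>
    rw [← pairing_cupHead_boundary s k (Finsupp.supported_mono (fun l hl => hl.1) (hc (k + 1))),
      hb k (by omega), ← ih fun j hj => hb j (by omega), map_add]
    refine eq_of_chainsOn (pairing (cupHead s) + pairing (cupHead s) ∘ₗ antipode) (pairing (cup s)) ?_ (hc k)
    rintro l ⟨hl, hK⟩
    rw [LinearMap.add_apply, LinearMap.comp_apply, antipode_single, pairing_single, pairing_single,
      pairing_single]
    exact cupHead_add_map_neg (by rintro rfl; simp at hl) fun i x hx => hs i x (hK x hx)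

end Index

section Subdivision

variable {E : Type*} [NormedAddCommGroup E] [NormedSpace ℝ E]

/-- The barycenter of a simplex. -/
noncomputable def barycenter (l : List E) : E := (l.length : ℝ)⁻¹ • l.sum

lemma barycenter_map_neg (l : List E) : barycenter (l.map Neg.neg) = -barycenter l := by
  have h : (l.map Neg.neg).sum = -l.sum := by
    induction l with
    | nil => simp
    | cons v l ih => simp only [List.map_cons, List.sum_cons, ih, neg_add]
  rw [barycenter, barycenter, h, List.length_map, smul_neg]

lemma barycenter_mem {C : Set E} (hC : Convex ℝ C) {l : List E} (hl : l ≠ [])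
    (h : ∀ x ∈ l, x ∈ C) : barycenter l ∈ C := by
  have hpos : (0 : ℝ) < l.length := by exact_mod_cast List.length_pos_iff.2 hl
  have := hC.sum_mem (t := Finset.univ) (w := fun _ : Fin l.length => (l.length : ℝ)⁻¹)
    (z := fun i => l[i]) (fun _ _ => by positivity) (by simp [hpos.ne'])
    (fun i _ => h _ (List.getElem_mem _))
  rw [← Finset.smul_sum] at this
  have hsum := Fin.sum_univ_fun_getElem l fun x => x
  rw [List.map_id'] at hsum
  rwa [barycenter, ← hsum]

lemma norm_sum_sub_smul_le {l : List E} {v : E} {δ : ℝ} (h : ∀ x ∈ l, dist x v ≤ δ) :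
    ‖l.sum - (l.length : ℝ) • v‖ ≤ l.length * δ := by
  induction l with
  | nil => simp
  | cons x l ih =>
    have h1 := h x (by simp)
    have h2 := ih fun y hy => h y (List.mem_cons_of_mem _ hy)
    rw [dist_eq_norm] at h1
    calc ‖(x :: l).sum - ((x :: l).length : ℝ) • v‖
        = ‖(x - v) + (l.sum - (l.length : ℝ) • v)‖ := by
          congr 1
          simp only [List.sum_cons, List.length_cons, Nat.cast_add, Nat.cast_one]
          module
      _ ≤ δ + l.length * δ := (norm_add_le _ _).trans (add_le_add h1 h2)
      _ = (x :: l).length * δ := by push_cast [List.length_cons]; ring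

lemma dist_barycenter_le {l : List E} {v : E} (hv : v ∈ l) {δ : ℝ}
    (h : ∀ x ∈ l, dist x v ≤ δ) {N : ℕ} (hN : l.length ≤ N + 1) :
    dist v (barycenter l) ≤ N / (N + 1) * δ := by
  classical
  have hperm := List.perm_cons_erase hv
  have hlen : (l.length : ℝ) = (l.erase v).length + 1 := by
    exact_mod_cast hperm.length_eq
  have hb : barycenter l - v = (l.length : ℝ)⁻¹ •
      ((l.erase v).sum - ((l.erase v).length : ℝ) • v) := by
    have h0 : (l.length : ℝ) ≠ 0 := by rw [hlen]; positivity
    rw [barycenter, hperm.sum_eq, List.sum_cons, eq_inv_smul_iff₀ h0, smul_sub,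
      smul_inv_smul₀ h0, hlen]
    module
  have hδ : 0 ≤ δ := dist_nonneg.trans (h v hv)
  have hm := norm_sum_sub_smul_le (l := l.erase v) fun x hx => h x (List.mem_of_mem_erase hx)
  rw [dist_comm, dist_eq_norm, hb, norm_smul, norm_inv, hlen]
  have hN' : ((l.erase v).length : ℝ) ≤ N := by
    have : (l.length : ℝ) ≤ N + 1 := by exact_mod_cast hN
    linarith
  set m : ℝ := ((l.erase v).length : ℝ)
  have hm0 : 0 ≤ m := Nat.cast_nonneg _
  rw [Real.norm_of_nonneg (by positivity)]
  calc (m + 1)⁻¹ * _ ≤ (m + 1)⁻¹ * (m * δ) := by gcongr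
    _ = m / (m + 1) * δ := by ring
    _ ≤ N / (N + 1) * δ := by
      gcongr ?_ * δ
      rw [div_le_div_iff₀ (by positivity) (by positivity)]
      nlinarith

/-- Barycentric subdivision of chains of simplices with `n` vertices. -/
noncomputable def subdiv : ℕ → Chain E →ₗ[ZMod 2] Chain E
  | 0 => LinearMap.id
  | n + 1 => Finsupp.linearCombination _ fun l => cone (barycenter l) (subdiv n (simplexBoundary l))

lemma subdiv_succ_single (n : ℕ) (l : List E) : subdiv (n + 1) (Finsupp.single l 1) =
    cone (barycenter l) (subdiv n (simplexBoundary l)) := by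
  simp [subdiv]

lemma boundary_subdiv (n : ℕ) {c : Chain E} (hc : c ∈ chainsOn fun l => l.length = n + 1) :
    boundary (subdiv (n + 1) c) = subdiv n (boundary c) := by
  induction n generalizing c with
  | zero =>
    rw [← LinearMap.comp_apply, ← LinearMap.comp_apply]
    refine eq_of_chainsOn _ _ (fun l hl => ?_) hc
    obtain ⟨v, rfl⟩ := List.length_eq_one_iff.1 hl
    rw [LinearMap.comp_apply, LinearMap.comp_apply, subdiv_succ_single]
    simp [simplexBoundary, subdiv]
  | succ n ih =>
    rw [← LinearMap.comp_apply, ← LinearMap.comp_apply]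
    refine eq_of_chainsOn _ _ (fun l hl => ?_) hc
    rw [LinearMap.comp_apply, LinearMap.comp_apply, subdiv_succ_single, boundary_cone,
      ih (simplexBoundary_mem_length hl), boundary_simplexBoundary, map_zero, map_zero, add_zero,
      boundary_single]

lemma antipode_subdiv (n : ℕ) (c : Chain E) :
    antipode (subdiv n c) = subdiv n (antipode c) := by
  induction n generalizing c with
  | zero => rfl
  | succ n ih =>
    have h : antipode ∘ₗ subdiv (n + 1) = subdiv (n + 1) ∘ₗ (antipode : Chain E →ₗ[ZMod 2] _) := by
      ext l : 2
      simp only [LinearMap.comp_apply, Finsupp.lsingle_apply, antipode_single]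
      rw [subdiv_succ_single, subdiv_succ_single, antipode_cone, ih, simplexBoundary_map_neg,
        barycenter_map_neg]
    exact LinearMap.congr_fun h c

/-- The simplices of the subdivision of a simplex lie in its convex hull and are smaller by a
factor. -/
lemma subdiv_single_mem {N n : ℕ} (hn : n ≤ N + 1) {l : List E} (hl : l.length = n) :
    subdiv n (Finsupp.single l 1) ∈ chainsOn fun t => t.length = n ∧
      (∀ C : Set E, Convex ℝ C → (∀ x ∈ l, x ∈ C) → ∀ x ∈ t, x ∈ C) ∧
      ∀ δ : ℝ, (∀ x ∈ l, ∀ y ∈ l, dist x y ≤ δ) →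
        ∀ x ∈ t, ∀ y ∈ t, dist x y ≤ N / (N + 1) * δ := by
  induction n generalizing l with
  | zero =>
    obtain rfl := List.length_eq_zero_iff.1 hl
    exact single_mem_chainsOn ⟨rfl, by simp, by simp⟩
  | succ n ih =>
    have hne : l ≠ [] := by rintro rfl; simp at hl
    rw [subdiv_succ_single]
    refine cone_mem_chainsOn (P := fun t => t.length = n ∧
      (∀ C : Set E, Convex ℝ C → (∀ x ∈ l, x ∈ C) → ∀ x ∈ t, x ∈ C) ∧
      ∀ δ : ℝ, (∀ x ∈ l, ∀ y ∈ l, dist x y ≤ δ) →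
        ∀ x ∈ t, ∀ y ∈ t, dist x y ≤ N / (N + 1) * δ) ?_
      (chainsOn_induction _ _ ?_ (simplexBoundary_mem l))
    · rintro t ⟨h1, h2, h3⟩
      refine ⟨by simp [h1], ?_, ?_⟩
      · intro C hC hlC x hx
        rcases List.mem_cons.1 hx with rfl | hx
        · exact barycenter_mem hC hne hlC
        · exact h2 C hC hlC x hx
      · intro δ hδ
        have hδ0 : 0 ≤ δ := by
          obtain ⟨x, hx⟩ := List.exists_mem_of_ne_nil l hne
          exact dist_nonneg.trans (hδ x hx x hx)
        have key : ∀ x ∈ t, dist x (barycenter l) ≤ N / (N + 1) * δ := fun x hx =>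
          h2 (Metric.closedBall (barycenter l) (N / (N + 1) * δ)) (convex_closedBall _ _)
            (fun v hv => dist_barycenter_le hv (fun x hx => hδ x hx v hv) (by omega)) x hx
        intro x hx y hy
        rcases List.mem_cons.1 hx with rfl | hx <;> rcases List.mem_cons.1 hy with rfl | hy
        · rw [dist_self]; positivity
        · rw [dist_comm]; exact key y hy
        · exact key x hx
        · exact h3 δ hδ x hx y hy
    · rintro t ⟨htl, hts⟩
      refine Finsupp.supported_mono ?_ (ih (by omega) (l := t) (by omega))
      rintro u ⟨h1, h2, h3⟩
      exact ⟨h1, fun C hC h => h2 C hC fun x hx => h x (hts hx),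
        fun δ h => h3 δ fun x hx y hy => h x (hts hx) y (hts hy)⟩

/-- The simplices with `n` vertices of diameter at most `δ`, lying in a member of the family `𝒞`. -/
def IsFine (𝒞 : Set (Set E)) (n : ℕ) (δ : ℝ) (l : List E) : Prop :=
  l.length = n ∧ (∃ C ∈ 𝒞, ∀ x ∈ l, x ∈ C) ∧ ∀ x ∈ l, ∀ y ∈ l, dist x y ≤ δ

lemma subdiv_iterate_mem {𝒞 : Set (Set E)} (h𝒞 : ∀ C ∈ 𝒞, Convex ℝ C) {N n : ℕ} (hn : n ≤ N + 1)
    {δ : ℝ} {c : Chain E} (hc : c ∈ chainsOn (IsFine 𝒞 n δ)) (m : ℕ) :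
    (subdiv n)^[m] c ∈ chainsOn (IsFine 𝒞 n ((N / (N + 1)) ^ m * δ)) := by
  induction m with
  | zero => simpa using hc
  | succ m ih =>
    rw [Function.iterate_succ_apply']
    refine chainsOn_induction _ _ ?_ ih
    rintro l ⟨hl, ⟨C, hC, hlC⟩, hd⟩
    refine Finsupp.supported_mono ?_ (subdiv_single_mem hn hl)
    rintro t ⟨h1, h2, h3⟩
    refine ⟨h1, ⟨C, hC, h2 C (h𝒞 C hC) hlC⟩, ?_⟩
    rw [pow_succ', mul_assoc]
    exact h3 _ hd

lemma subdiv_mem_length {n : ℕ} {c : Chain E} (hc : c ∈ chainsOn fun l => l.length = n) :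
    subdiv n c ∈ chainsOn fun l => l.length = n :=
  chainsOn_induction _ _ (fun _ hl => Finsupp.supported_mono (fun _ ht => ht.1)
    (subdiv_single_mem (Nat.le_succ n) hl)) hc

lemma boundary_subdiv_iterate (n m : ℕ) {c : Chain E}
    (hc : c ∈ chainsOn fun l => l.length = n + 1) :
    boundary ((subdiv (n + 1))^[m] c) = (subdiv n)^[m] (boundary c) := by
  induction m generalizing c with
  | zero => rfl
  | succ m ih =>
    rw [Function.iterate_succ_apply, Function.iterate_succ_apply, ih (subdiv_mem_length hc),
      boundary_subdiv n hc]

end Subdivision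

end ListChain

section BorsukUlam

open ListChain

/-- The face of the `ℓ¹`-sphere in the orthant with signs `ε`. -/
def orthantFace {ι : Type*} [Fintype ι] (ε : ι → ℤˣ) : Set (ι → ℝ) :=
  {x | (∀ i, 0 ≤ ((ε i : ℤ) : ℝ) * x i) ∧ ∑ i, ((ε i : ℤ) : ℝ) * x i = 1}

lemma convex_orthantFace {ι : Type*} [Fintype ι] (ε : ι → ℤˣ) : Convex ℝ (orthantFace ε) := by
  rintro x ⟨hx, hx1⟩ y ⟨hy, hy1⟩ a b ha hb hab
  have h : ∀ i, ((ε i : ℤ) : ℝ) * (a • x + b • y) i =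
      a * (((ε i : ℤ) : ℝ) * x i) + b * (((ε i : ℤ) : ℝ) * y i) := fun i => by
    simp only [Pi.add_apply, Pi.smul_apply, smul_eq_mul]; ring
  refine ⟨fun i => ?_, ?_⟩
  · rw [h]
    exact add_nonneg (mul_nonneg ha (hx i)) (mul_nonneg hb (hy i))
  · simp only [h, Finset.sum_add_distrib, ← Finset.mul_sum, hx1, hy1]
    linarith

lemma sum_abs_eq_one_of_mem_orthantFace {ι : Type*} [Fintype ι] {ε : ι → ℤˣ} {x : ι → ℝ}
    (hx : x ∈ orthantFace ε) : ∑ i, |x i| = 1 := by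
  rw [← hx.2]
  refine Finset.sum_congr rfl fun i _ => ?_
  rw [← abs_of_nonneg (hx.1 i), abs_mul]
  rcases Int.units_eq_one_or (ε i) with h | h <;> simp [h]

lemma smul_single_mem_orthantFace {ι : Type*} [Fintype ι] [DecidableEq ι] (ε : ι → ℤˣ) (i : ι) :
    (ε i : ℤ) • (Pi.single i 1 : ι → ℝ) ∈ orthantFace ε := by
  have h : ((ε i : ℤ) : ℝ) * ((ε i : ℤ) : ℝ) = 1 := by
    rcases Int.units_eq_one_or (ε i) with h | h <;> simp [h]
  refine ⟨fun j => ?_, ?_⟩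
  · rcases eq_or_ne j i with rfl | hj
    · simp [h]
    · simp [hj]
  · simp [Pi.single_apply, h]

lemma norm_le_sum_abs {ι : Type*} [Fintype ι] (x : ι → ℝ) : ‖x‖ ≤ ∑ i, |x i| := by
  rw [pi_norm_le_iff_of_nonneg (Finset.sum_nonneg fun i _ => abs_nonneg _)]
  intro i
  exact Finset.single_le_sum (f := fun i => |x i|) (fun _ _ => abs_nonneg _) (Finset.mem_univ i)

lemma isCompact_sum_abs_eq_one (ι : Type*) [Fintype ι] : IsCompact {x : ι → ℝ | ∑ i, |x i| = 1} := by
  refine Metric.isCompact_of_isClosed_isBounded (isClosed_eq (by fun_prop) continuous_const) ?_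
  refine (Metric.isBounded_closedBall (x := (0 : ι → ℝ)) (r := 1)).subset fun x hx => ?_
  exact mem_closedBall_zero_iff.2 ((norm_le_sum_abs x).trans_eq hx)

open Classical in
/-- The sign of `f x` as an element of `ZMod 2`, where ties are broken lexicographically. -/
noncomputable def signBit {n : ℕ} (f : (Fin n → ℝ) → ℝ) (x : Fin n → ℝ) : ZMod 2 :=
  if 0 < f x ∨ f x = 0 ∧ 0 < toLex x then 1 else 0

lemma signBit_neg {n : ℕ} {f : (Fin n → ℝ) → ℝ} {x : Fin n → ℝ} (hx : x ≠ 0)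
    (hf : f (-x) = -f x) : signBit f (-x) = signBit f x + 1 := by
  have h1 : (1 : ZMod 2) + 1 = 0 := CharTwo.add_self_eq_zero 1
  have hlex : 0 < toLex (-x) ↔ ¬ 0 < toLex x := by
    have h0 : toLex x ≠ 0 := fun h => hx (toLex.injective h)
    rw [toLex_neg, neg_pos]
    exact ⟨fun h => lt_asymm h, fun h => (lt_or_gt_of_ne h0).resolve_right h⟩
  rw [signBit, signBit, hf, hlex]
  rcases lt_trichotomy (f x) 0 with h | h | h
  · simp [h, h.le, h.ne]
  · by_cases h' : 0 < toLex x <;> simp [h, h', h1]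
  · simp [h, h.le, h.ne', h1]

/-- The **Borsuk-Ulam theorem**. -/
theorem borsuk_ulam {n : ℕ} (F : (Fin (n + 1) → ℝ) → (Fin n → ℝ)) (hF : Continuous F)
    (hodd : ∀ x, F (-x) = -F x) : ∃ x ≠ 0, F x = 0 := by
  by_contra! hne
  set K : Set (Fin (n + 1) → ℝ) := {x | ∑ i, |x i| = 1} with hK
  have hKc : IsCompact K := isCompact_sum_abs_eq_one _
  have hK0 : ∀ x ∈ K, x ≠ 0 := by
    rintro x hx rfl
    simp [hK] at hx
  obtain ⟨r, hr, hrF⟩ : ∃ r > 0, ∀ x ∈ K, r ≤ ‖F x‖ :=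
    hKc.exists_forall_le' hF.norm.continuousOn fun x hx => norm_pos_iff.2 (hne x (hK0 x hx))
  obtain ⟨δ, hδ, hFδ⟩ := Metric.uniformContinuousOn_iff.1
    (hKc.uniformContinuousOn_of_continuous hF.continuousOn) r hr
  obtain ⟨m, hm⟩ : ∃ m : ℕ, ((n : ℝ) / (n + 1)) ^ m < δ / 2 :=
    exists_pow_lt_of_lt_one (by positivity) (by rw [div_lt_one (by positivity)]; linarith)
  let v : ℕ → Fin (n + 1) → ℝ := fun i => Pi.single (Fin.ofNat (n + 1) i) 1
  let 𝒞 : Set (Set (Fin (n + 1) → ℝ)) := Set.range orthantFace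
  have h𝒞K : ∀ C ∈ 𝒞, C ⊆ K := by
    rintro _ ⟨ε, rfl⟩ x hx
    exact sum_abs_eq_one_of_mem_orthantFace hx
  have h𝒞 : ∀ C ∈ 𝒞, Convex ℝ C := by
    rintro _ ⟨ε, rfl⟩
    exact convex_orthantFace ε
  have hhem : ∀ k ≤ n, hemisphere v k ∈ chainsOn (IsFine 𝒞 (k + 1) 2) := by
    intro k hk
    refine Finsupp.supported_mono ?_ (hemisphere_mem v k)
    rintro l ⟨hl, ε, hε⟩
    have hlC : ∀ x ∈ l, x ∈ orthantFace fun i : Fin (n + 1) => ε i := by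
      intro x hx
      obtain ⟨i, hi, rfl⟩ := hε x hx
      have := smul_single_mem_orthantFace (fun i : Fin (n + 1) => ε i) (Fin.ofNat (n + 1) i)
      simpa [v, Nat.mod_eq_of_lt (show i < n + 1 by omega)] using this
    have hnorm : ∀ x ∈ l, ‖x‖ ≤ 1 := fun x hx =>
      (norm_le_sum_abs x).trans_eq (sum_abs_eq_one_of_mem_orthantFace (hlC x hx))
    refine ⟨hl, ⟨_, ⟨_, rfl⟩, hlC⟩, fun x hx y hy => ?_⟩
    rw [dist_eq_norm]
    linarith [norm_sub_le x y, hnorm x hx, hnorm y hy]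
  let c : ℕ → Chain (Fin (n + 1) → ℝ) := fun k =>
    if k ≤ n then (subdiv (k + 1))^[m] (hemisphere v k) else 0
  have hcfine : ∀ k, c k ∈ chainsOn (IsFine 𝒞 (k + 1) ((n / (n + 1)) ^ m * 2)) := by
    intro k
    by_cases hk : k ≤ n
    · simp only [c, if_pos hk]
      exact subdiv_iterate_mem h𝒞 (by omega) (hhem k hk) m
    · simp only [c, if_neg hk]
      exact Submodule.zero_mem _
  let s : ℕ → (Fin (n + 1) → ℝ) → ZMod 2 := fun i =>
    signBit fun x => if h : i < n then F x ⟨i, h⟩ else 0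
  have hone : pairing (cup s) (c n) = 1 := by
    refine pairing_cup_eq_one (K := K) (x₀ := v 0) ?_ ?_ ?_ n ?_
    · intro i x hx
      refine signBit_neg (hK0 x hx) ?_
      split_ifs <;> simp [hodd]
    · simp only [c, if_pos (Nat.zero_le n)]
      refine Function.iterate_fixed ?_ m
      simp [hemisphere, subdiv, simplexBoundary, barycenter]
    · intro k
      refine Finsupp.supported_mono ?_ (hcfine k)
      rintro l ⟨hl, ⟨C, hC, hlC⟩, -⟩
      exact ⟨hl, fun x hx => h𝒞K C hC (hlC x hx)⟩
    · intro j hj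
      simp only [c, if_pos (show j ≤ n by omega), if_pos (show j + 1 ≤ n by omega)]
      rw [boundary_subdiv_iterate _ _ (Finsupp.supported_mono (fun l hl => hl.1) (hhem (j + 1) hj)),
        boundary_hemisphere_succ, iterate_map_add, Function.Commute.iterate_right
          (f := antipode) (g := subdiv (j + 1)) (fun x => antipode_subdiv _ x)]
  have hzero : pairing (cup s) (c n) ∈ (⊥ : Submodule (ZMod 2) (ZMod 2)) := by
    refine chainsOn_induction _ _ ?_ (hcfine n)
    rintro l ⟨hl, ⟨C, hC, hlC⟩, hd⟩
    rw [pairing_single, Submodule.mem_bot]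
    obtain ⟨x₀, hx₀⟩ := List.exists_mem_of_length_pos (l := l) (by omega)
    have hlK : ∀ x ∈ l, x ∈ K := fun x hx => h𝒞K C hC (hlC x hx)
    obtain ⟨i, hi⟩ : ∃ i, r ≤ |F x₀ i| := by
      by_contra! h
      exact absurd ((pi_norm_lt_iff hr).2 h) (not_lt.2 (hrF x₀ (hlK x₀ hx₀)))
    have hclose : ∀ x ∈ l, |F x i - F x₀ i| < r := by
      intro x hx
      have h1 := hFδ x (hlK x hx) x₀ (hlK x₀ hx₀) (lt_of_le_of_lt (hd x hx x₀ hx₀) (by linarith))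
      rw [dist_eq_norm] at h1
      exact lt_of_le_of_lt (norm_le_pi_norm (F x - F x₀) i) h1
    have hconst : ∀ x ∈ l, s i x = s i x₀ := by
      intro x hx
      have h1 := abs_lt.1 (hclose x hx)
      simp only [s, signBit, dif_pos i.2, Fin.eta]
      rcases le_abs'.1 hi with h | h
      · have h2 : F x i < 0 := by linarith
        have h3 : F x₀ i < 0 := by linarith
        simp [h2.ne, h3.ne, h2.not_gt, h3.not_gt]
      · have h2 : 0 < F x i := by linarith
        have h3 : 0 < F x₀ i := by linarith
        simp [h2, h3]
    exact cup_eq_zero (i := i) (by omega) fun x hx y hy => by rw [hconst x hx, hconst y hy]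
  rw [hone, Submodule.mem_bot] at hzero
  exact one_ne_zero hzero

end BorsukUlam

section Truncation

variable {ι : Type*} [Fintype ι]

/-- The `(k + 1)`-st largest value of `x`, for `k + 1` at most the number of indices. -/
noncomputable def kthMax (k : ℕ) [Nonempty (Fin (k + 1) ↪ ι)] (x : ι → ℝ) : ℝ :=
  Finset.univ.sup' Finset.univ_nonempty fun σ : Fin (k + 1) ↪ ι =>
    Finset.univ.inf' Finset.univ_nonempty fun j => x (σ j)

variable (k : ℕ) [Nonempty (Fin (k + 1) ↪ ι)]

lemma continuous_kthMax : Continuous (kthMax k : (ι → ℝ) → ℝ) :=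
  Continuous.finset_sup'_apply _ fun _ _ => Continuous.finset_inf'_apply _ fun _ _ =>
    continuous_apply _

lemma lt_kthMax_iff {x : ι → ℝ} {a : ℝ} :
    a < kthMax k x ↔ k < (Finset.univ.filter fun i => a < x i).card := by
  simp only [kthMax, Finset.lt_sup'_iff, Finset.lt_inf'_iff, Finset.mem_univ, true_and,
    forall_const]
  constructor
  · rintro ⟨σ, hσ⟩
    have h : Finset.univ.map σ ⊆ Finset.univ.filter fun i => a < x i := by
      intro i hi
      obtain ⟨j, -, rfl⟩ := Finset.mem_map.1 hi
      exact Finset.mem_filter.2 ⟨Finset.mem_univ _, hσ j⟩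
    simpa using Finset.card_le_card h
  · intro h
    obtain ⟨e⟩ : Nonempty (Fin (k + 1) ↪ ↥(Finset.univ.filter fun i => a < x i)) :=
      Function.Embedding.nonempty_of_card_le (by rw [Fintype.card_fin, Fintype.card_coe]; exact h)
    exact ⟨e.trans (Function.Embedding.subtype _), fun j => (Finset.mem_filter.1 (e j).2).2⟩

lemma kthMax_nonneg {x : ι → ℝ} (hx : ∀ i, 0 ≤ x i) : 0 ≤ kthMax k x := by
  obtain ⟨σ⟩ := ‹Nonempty (Fin (k + 1) ↪ ι)›
  exact (Finset.le_inf' _ _ fun j _ => hx (σ j)).trans (Finset.le_sup' (fun σ : Fin (k + 1) ↪ ι =>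
    Finset.univ.inf' Finset.univ_nonempty fun j => x (σ j)) (Finset.mem_univ σ))

/-- The map lowering all coordinates by the `(k + 1)`-st largest one and cutting off at `0`. -/
noncomputable def truncate (x : ι → ℝ) : ι → ℝ := fun i => max (x i - kthMax k x) 0

lemma continuous_truncate : Continuous (truncate k : (ι → ℝ) → ι → ℝ) := by
  have := continuous_kthMax (ι := ι) k
  unfold truncate
  fun_prop

lemma truncate_nonneg (x : ι → ℝ) (i : ι) : 0 ≤ truncate k x i := le_max_right _ _

lemma card_truncate_ne_zero_le (x : ι → ℝ) :
    (Finset.univ.filter fun i => truncate k x i ≠ 0).card ≤ k := by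
  have h := (lt_kthMax_iff k (x := x)).not.1 (lt_irrefl _)
  refine (Finset.card_le_card fun i hi => ?_).trans (not_lt.1 h)
  simp only [Finset.mem_filter, Finset.mem_univ, true_and] at hi ⊢
  by_contra h'
  exact hi (max_eq_right (by linarith))

lemma truncate_eq_self {x : ι → ℝ} (hx : ∀ i, 0 ≤ x i) (h : kthMax k x = 0) :
    truncate k x = x := by
  ext i
  rw [truncate, h, sub_zero, max_eq_left (hx i)]

/-- When there are few indices, `z` cannot have many positive and many negative coordinates. -/
lemma kthMax_posPart_eq_zero (hk : Fintype.card ι < 2 * (k + 1)) {z : ι → ℝ}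
    (h : kthMax k z⁺ = kthMax k (-z)⁺) : kthMax k z⁺ = 0 := by
  have hnn := kthMax_nonneg k (x := z⁺) fun i => posPart_nonneg z i
  by_contra hne
  have h1 : 0 < kthMax k z⁺ := lt_of_le_of_ne hnn (Ne.symm hne)
  have h2 := h ▸ h1
  rw [lt_kthMax_iff] at h1 h2
  have hdisj : Disjoint (Finset.univ.filter fun i => 0 < z⁺ i)
      (Finset.univ.filter fun i => 0 < (-z)⁺ i) := by
    rw [Finset.disjoint_filter]
    intro i _ hi hi'
    simp only [Pi.posPart_apply, Pi.neg_apply, posPart_pos_iff] at hi hi'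
    linarith
  have := Finset.card_le_univ ((Finset.univ.filter fun i => 0 < z⁺ i).disjUnion
    (Finset.univ.filter fun i => 0 < (-z)⁺ i) hdisj)
  rw [Finset.card_disjUnion] at this
  omega

end Truncation

section VanKampenFlores

/-- The underlying set of the skeleton. -/
def skelSet (d : ℕ) : Set (Fin (2 * d + 3) → ℝ) :=
  {x | (∀ i, 0 ≤ x i) ∧ (∑ i, x i) = 1 ∧ (Finset.univ.filter fun i => x i ≠ 0).card ≤ d + 1}

instance (d : ℕ) : Nonempty (Fin (d + 1 + 1) ↪ Fin (2 * d + 3)) :=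
  ⟨Fin.castLEEmb (by omega)⟩

lemma inv_smul_truncate_mem_skelSet {d : ℕ} {x : Fin (2 * d + 3) → ℝ}
    (hx : ∑ i, truncate (d + 1) x i ≠ 0) :
    (∑ i, truncate (d + 1) x i)⁻¹ • truncate (d + 1) x ∈ skelSet d := by
  have h0 : 0 ≤ ∑ i, truncate (d + 1) x i := Finset.sum_nonneg fun i _ => truncate_nonneg _ _ _
  refine ⟨fun i => mul_nonneg (inv_nonneg.2 h0) (truncate_nonneg _ _ _), ?_, ?_⟩
  · simp only [Pi.smul_apply, smul_eq_mul, ← Finset.mul_sum]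
    exact inv_mul_cancel₀ hx
  · simpa [hx] using card_truncate_ne_zero_le (d + 1) x

/-- The homogeneous extension of a map on the skeleton, precomposed with the truncation. -/
noncomputable def coneExtension {d : ℕ} {E : Type*} [AddCommGroup E] [Module ℝ E]
    (g : (Fin (2 * d + 3) → ℝ) → E) (x : Fin (2 * d + 3) → ℝ) : E :=
  (∑ i, truncate (d + 1) x i) • g ((∑ i, truncate (d + 1) x i)⁻¹ • truncate (d + 1) x)

variable {d : ℕ} {E : Type*} [NormedAddCommGroup E] [NormedSpace ℝ E]
  {g : (Fin (2 * d + 3) → ℝ) → E}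

lemma norm_coneExtension (hg1 : ∀ x ∈ skelSet d, ‖g x‖ = 1) (x : Fin (2 * d + 3) → ℝ) :
    ‖coneExtension g x‖ = ∑ i, truncate (d + 1) x i := by
  have h0 : 0 ≤ ∑ i, truncate (d + 1) x i := Finset.sum_nonneg fun i _ => truncate_nonneg _ _ _
  by_cases hx : ∑ i, truncate (d + 1) x i = 0
  · simp [coneExtension, hx]
  · rw [coneExtension, norm_smul, hg1 _ (inv_smul_truncate_mem_skelSet hx), mul_one,
      Real.norm_of_nonneg h0]

lemma continuous_coneExtension (hg : ContinuousOn g (skelSet d))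
    (hg1 : ∀ x ∈ skelSet d, ‖g x‖ = 1) : Continuous (coneExtension g) := by
  have ht := continuous_truncate (ι := Fin (2 * d + 3)) (d + 1)
  have hs : Continuous fun x : Fin (2 * d + 3) → ℝ => ∑ i, truncate (d + 1) x i := by fun_prop
  rw [continuous_iff_continuousAt]
  intro x
  by_cases hx : ∑ i, truncate (d + 1) x i = 0
  · have h0 : coneExtension g x = 0 := by simp [coneExtension, hx]
    rw [ContinuousAt, h0, tendsto_zero_iff_norm_tendsto_zero, funext (norm_coneExtension hg1), ← hx]
    exact hs.continuousAt
  · have hU : IsOpen {y : Fin (2 * d + 3) → ℝ | ∑ i, truncate (d + 1) y i ≠ 0} :=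
      isOpen_ne_fun hs continuous_const
    refine ContinuousOn.continuousAt (s := {y | ∑ i, truncate (d + 1) y i ≠ 0}) ?_
      (hU.mem_nhds hx)
    refine hs.continuousOn.smul (hg.comp ?_ fun y hy => inv_smul_truncate_mem_skelSet hy)
    exact (hs.continuousOn.inv₀ fun y hy => hy).smul ht.continuousOn

lemma eq_of_coneExtension_eq (hg1 : ∀ x ∈ skelSet d, ‖g x‖ = 1) (hinj : Set.InjOn g (skelSet d))
    {x y : Fin (2 * d + 3) → ℝ} (h : coneExtension g x = coneExtension g y) :
    truncate (d + 1) x = truncate (d + 1) y := by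
  have hs : ∑ i, truncate (d + 1) x i = ∑ i, truncate (d + 1) y i := by
    rw [← norm_coneExtension hg1, h, norm_coneExtension hg1]
  by_cases hx : ∑ i, truncate (d + 1) x i = 0
  · have hy := hs ▸ hx
    rw [Finset.sum_eq_zero_iff_of_nonneg fun i _ => truncate_nonneg _ _ _] at hx hy
    ext i
    rw [hx i (Finset.mem_univ i), hy i (Finset.mem_univ i)]
  · rw [coneExtension, coneExtension, ← hs] at h
    have hy := inv_smul_truncate_mem_skelSet (hs ▸ hx)
    rw [← hs] at hy
    have := hinj (inv_smul_truncate_mem_skelSet hx) hy (smul_right_injective E hx h)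
    exact smul_right_injective _ (inv_ne_zero hx) this

lemma continuous_posPart_pi {ι : Type*} : Continuous fun z : ι → ℝ => z⁺ :=
  continuous_pi fun i => (continuous_apply i).max continuous_const

end VanKampenFlores

/-- The van Kampen–Flores theorem: the `d`-skeleton of the `(2d+2)`-simplex does not embed
in the `2d`-sphere (the unit sphere of `ℝ^{2d+1}`). -/
theorem vanKampen_Flores (d : ℕ) :
    ¬ ∃ f : VKskel d → Metric.sphere (0 : EuclideanSpace ℝ (Fin (2 * d + 1))) 1,
        Continuous f ∧ Function.Injective f := by
  rintro ⟨f, hf, hinj⟩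
  classical
  let g : (Fin (2 * d + 3) → ℝ) → EuclideanSpace ℝ (Fin (2 * d + 1)) :=
    fun x => if h : x ∈ skelSet d then (f ⟨x, h⟩ : EuclideanSpace ℝ (Fin (2 * d + 1))) else 0
  have hgf : ∀ x (hx : x ∈ skelSet d), g x = f ⟨x, hx⟩ := fun x hx => dif_pos hx
  have hg : ContinuousOn g (skelSet d) := by
    rw [continuousOn_iff_continuous_domRestrict]
    have : (skelSet d).domRestrict g = fun x => (f x : EuclideanSpace ℝ (Fin (2 * d + 1))) :=
      funext fun x => hgf x x.2
    rw [this]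
    exact continuous_subtype_val.comp hf
  have hg1 : ∀ x ∈ skelSet d, ‖g x‖ = 1 := fun x hx => by
    rw [hgf x hx]
    exact mem_sphere_zero_iff_norm.1 (f ⟨x, hx⟩).2
  have hginj : Set.InjOn g (skelSet d) := fun x hx y hy h => by
    rw [hgf x hx, hgf y hy] at h
    exact congrArg Subtype.val (hinj (Subtype.ext h))
  have hG := continuous_coneExtension hg hg1
  have hm := continuous_kthMax (ι := Fin (2 * d + 3)) (d + 1)
  have hp := continuous_posPart_pi (ι := Fin (2 * d + 3))
  let F : (Fin (2 * d + 3) → ℝ) → Fin (2 * d + 2) → ℝ := fun z =>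
    Fin.cons (kthMax (d + 1) z⁺ - kthMax (d + 1) (-z)⁺)
      fun i => (coneExtension g z⁺ - coneExtension g (-z)⁺) i
  have hF : Continuous F := by
    refine continuous_pi fun i => Fin.cases ?_ (fun j => ?_) i
    · exact (hm.comp hp).sub (hm.comp (hp.comp continuous_neg))
    · exact (EuclideanSpace.proj (𝕜 := ℝ) j).continuous.comp
        ((hG.comp hp).sub (hG.comp (hp.comp continuous_neg)))
  obtain ⟨z, hz, hFz⟩ := borsuk_ulam F hF fun z => by
    ext i
    refine Fin.cases ?_ (fun j => ?_) i <;> simp [F]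
  have h0 : kthMax (d + 1) z⁺ = kthMax (d + 1) (-z)⁺ := sub_eq_zero.1 (congrFun hFz 0)
  have h1 : coneExtension g z⁺ = coneExtension g (-z)⁺ := by
    rw [← sub_eq_zero]
    ext j
    exact congrFun hFz j.succ
  have h2 := kthMax_posPart_eq_zero _ (by rw [Fintype.card_fin]; omega) h0
  have h3 := eq_of_coneExtension_eq hg1 hginj h1
  rw [truncate_eq_self _ (fun i => posPart_nonneg z i) h2,
    truncate_eq_self _ (fun i => posPart_nonneg (-z) i) (h0 ▸ h2), posPart_neg] at h3
  exact hz (by rw [← posPart_sub_negPart z, h3, sub_self])
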